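/- Γ-limsup inequality (recovery sequence): Let E ⊂ ℝ be a bounded open interval and let v : E → {α', β'} be a step function with exactly N jump points, i.e. there are points inf E = t₀ < t₁ < ⋯ < t_N < t_{N+1} = sup E such that v is constant on each (t_i, t_{i+1}) and takes different values on consecutive subintervals. Then for every sequence ε_n → 0⁺ there exists a sequence of measurable functions v_n on E with G_{ε_n}[v_n, E] < ∞, v_n → v in L¹(E), and limsup_{n→∞} G_{ε_n}[v_n, E] ≤ N · κ_s, where κ_s := inf{ G₁[v, ℝ] : v measurable with G₁[v, ℝ] < ∞, v(x) → α' as x → −∞, v(x) → β' as x → +∞ }. -/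

import Mathlib

open Real MeasureTheory Set Filter
open scoped ENNReal

/-- The Gagliardo-type double integral ∬_{E×E} |v(x') − v(x)|²/|x' − x|^{1+2s} dx' dx. -/
noncomputable def gag (s : ℝ) (E : Set ℝ) (v : ℝ → ℝ) : ℝ≥0∞ :=
  ∫⁻ x in E, ∫⁻ x' in E, ENNReal.ofReal ((v x' - v x) ^ 2 / |x' - x| ^ (1 + 2 * s))

/-- The functional
G_ε[v, E] := (ε^{1−a}/D) ∬_{E×E} |v(x')−v(x)|²/|x'−x|^{1+2s} + ε^{−(1−a)/(−a)} ∫_E V(v). -/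
noncomputable def Gfun (a s D : ℝ) (V : ℝ → ℝ) (ε : ℝ) (E : Set ℝ) (v : ℝ → ℝ) : ℝ≥0∞ :=
  ENNReal.ofReal (ε ^ (1 - a) / D) * gag s E v +
    ENNReal.ofReal (ε ^ (-((1 - a) / (-a)))) * ∫⁻ x in E, ENNReal.ofReal (V (v x))

/-- The functional G₁[v, ℝ] := (1/D) ∬ |v(x)−v(x')|²/|x−x'|^{1+2s} + ∫ V(v). -/
noncomputable def Gone (D s : ℝ) (V : ℝ → ℝ) (v : ℝ → ℝ) : ℝ≥0∞ :=
  ENNReal.ofReal (1 / D) * gag s univ v + ∫⁻ x, ENNReal.ofReal (V (v x))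

/-- The optimal-profile constant
κ_s := inf { G₁[v, ℝ] : v measurable, G₁[v, ℝ] < ∞, v → α' at −∞, v → β' at +∞ }. -/
noncomputable def kappa (D s α' β' : ℝ) (V : ℝ → ℝ) : ℝ≥0∞ :=
  sInf {t : ℝ≥0∞ | ∃ v : ℝ → ℝ, Measurable v ∧ Gone D s V v ≠ ⊤ ∧
    Tendsto v atBot (nhds α') ∧ Tendsto v atTop (nhds β') ∧ t = Gone D s V v}

lemma measurable_gag_kernel (s : ℝ) {v : ℝ → ℝ} (hv : Measurable v) :
    Measurable fun z : ℝ × ℝ =>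
      ENNReal.ofReal ((v z.2 - v z.1) ^ 2 / |z.2 - z.1| ^ (1 + 2 * s)) := by
  fun_prop

lemma gag_eq_lintegral_prod (s : ℝ) (E : Set ℝ) {v : ℝ → ℝ} (hv : Measurable v) :
    gag s E v = ∫⁻ z in E ×ˢ E,
      ENNReal.ofReal ((v z.2 - v z.1) ^ 2 / |z.2 - z.1| ^ (1 + 2 * s))
        ∂(volume.prod volume) := by
  rw [← Measure.prod_restrict, lintegral_prod _ (measurable_gag_kernel s hv).aemeasurable]
  rfl

/-- A pointwise bound on squared increments carries over to the Gagliardo energies. -/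
lemma gag_le_of_sq_increment_le (s : ℝ) {u v w : ℝ → ℝ} (hu : Measurable u) (hv : Measurable v)
    (hw : Measurable w) {A B : ℝ} (hA : 0 ≤ A) (hB : 0 ≤ B)
    (h : ∀ x y, (w y - w x) ^ 2 ≤ A * (u y - u x) ^ 2 + B * (v y - v x) ^ 2) :
    gag s univ w ≤ ENNReal.ofReal A * gag s univ u + ENNReal.ofReal B * gag s univ v := by
  have mu := measurable_gag_kernel s hu
  have mv := measurable_gag_kernel s hv
  rw [gag_eq_lintegral_prod s _ hu, gag_eq_lintegral_prod s _ hv, gag_eq_lintegral_prod s _ hw,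
    ← lintegral_const_mul _ mu, ← lintegral_const_mul _ mv, ← lintegral_add_left (by fun_prop)]
  refine lintegral_mono fun z => ?_
  have hp : 0 ≤ |z.2 - z.1| ^ (1 + 2 * s) := by positivity
  rw [← ENNReal.ofReal_mul hA, ← ENNReal.ofReal_mul hB, ← ENNReal.ofReal_add (by positivity)
    (by positivity)]
  apply ENNReal.ofReal_le_ofReal
  rw [← mul_div_assoc, ← mul_div_assoc, ← add_div]
  exact div_le_div_of_nonneg_right (h _ _) hp

lemma lintegral_comp_mul_sub {k : ℝ} (hk : k ≠ 0) (c : ℝ) {g : ℝ → ℝ≥0∞} (hg : Measurable g) :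
    ∫⁻ x, g (k * (x - c)) = ENNReal.ofReal |k⁻¹| * ∫⁻ x, g x := by
  rw [lintegral_sub_right_eq_self (fun x => g (k * x)) c,
    ← lintegral_map hg (measurable_const_mul k), Real.map_volume_mul_left hk,
    lintegral_smul_measure, smul_eq_mul]

lemma gag_comp_mul_sub (s : ℝ) {k : ℝ} (hk : k ≠ 0) (c : ℝ) {v : ℝ → ℝ} (hv : Measurable v) :
    gag s univ (fun x => v (k * (x - c))) = ENNReal.ofReal (|k| ^ (2 * s - 1)) * gag s univ v := by
  have mv := measurable_gag_kernel s hv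
  have hk' : 0 < |k| := abs_pos.2 hk
  have inner : ∀ x : ℝ, ∫⁻ x', ENNReal.ofReal ((v (k * (x' - c)) - v (k * (x - c))) ^ 2 /
      |x' - x| ^ (1 + 2 * s)) = ENNReal.ofReal (|k| ^ (2 * s)) *
      ∫⁻ y', ENNReal.ofReal ((v y' - v (k * (x - c))) ^ 2 /
        |y' - k * (x - c)| ^ (1 + 2 * s)) := by
    intro x
    have e : ∀ x' : ℝ, ENNReal.ofReal ((v (k * (x' - c)) - v (k * (x - c))) ^ 2 /
        |x' - x| ^ (1 + 2 * s)) = ENNReal.ofReal (|k| ^ (1 + 2 * s)) *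
        (fun y' => ENNReal.ofReal ((v y' - v (k * (x - c))) ^ 2 /
          |y' - k * (x - c)| ^ (1 + 2 * s))) (k * (x' - c)) := by
      intro x'
      have : k * (x' - c) - k * (x - c) = k * (x' - x) := by ring
      simp only [this, abs_mul]
      rw [← ENNReal.ofReal_mul (by positivity), mul_rpow (abs_nonneg _) (abs_nonneg _)]
      congr 1
      have : |k| ^ (1 + 2 * s) ≠ 0 := by positivity
      field_simp
    simp_rw [e]
    have mg : Measurable fun y' => ENNReal.ofReal ((v y' - v (k * (x - c))) ^ 2 /
        |y' - k * (x - c)| ^ (1 + 2 * s)) := by fun_prop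
    have hmg := lintegral_comp_mul_sub hk c mg
    beta_reduce at hmg
    rw [lintegral_const_mul _ (by fun_prop), hmg, ← mul_assoc,
      ← ENNReal.ofReal_mul (by positivity)]
    congr 2
    rw [abs_inv, rpow_add hk', rpow_one]
    field_simp
  simp only [gag, Measure.restrict_univ]
  simp_rw [inner]
  have mi : Measurable fun y : ℝ => ∫⁻ y', ENNReal.ofReal ((v y' - v y) ^ 2 /
        |y' - y| ^ (1 + 2 * s)) := mv.lintegral_prod_right'
  rw [lintegral_const_mul _ (by fun_prop), lintegral_comp_mul_sub hk c mi, ← mul_assoc,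
      ← ENNReal.ofReal_mul (by positivity)]
  congr 2
  rw [abs_inv, rpow_sub hk', rpow_one]
  rfl

/-- The energy on the line is invariant under reflection. -/
lemma Gone_comp_neg (D s : ℝ) {V v : ℝ → ℝ} (hV : Measurable V) (hv : Measurable v) :
    Gone D s V (fun x => v (-x)) = Gone D s V v := by
  have h1 := gag_comp_mul_sub s (k := -1) (by norm_num) 0 hv
  have h2 := lintegral_comp_mul_sub (k := -1) (by norm_num) 0
    (g := fun x => ENNReal.ofReal (V (v x))) (by fun_prop)
  simp at h1 h2
  simp only [Gone, h1, h2]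

/-- Blow-up invariance: rescaling by the optimal length turns the energy into `Gone`. -/
lemma Gfun_rescale {a s D ε : ℝ} (ha : a < 0) (hs : s = (1 - a) / 2) (hε : 0 < ε)
    {V v : ℝ → ℝ} (hV : Measurable V) (hv : Measurable v) (c : ℝ) :
    Gfun a s D V ε univ (fun x => v ((ε ^ ((1 - a) / (-a)))⁻¹ * (x - c))) = Gone D s V v := by
  have hη : 0 < ε ^ ((1 - a) / (-a)) := rpow_pos_of_pos hε _
  have hk : (ε ^ ((1 - a) / (-a)))⁻¹ ≠ 0 := (inv_pos.2 hη).ne'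
  have h2 := lintegral_comp_mul_sub hk c
    (g := fun x => ENNReal.ofReal (V (v x))) (by fun_prop)
  simp only [Gfun, Gone, Measure.restrict_univ, gag_comp_mul_sub s hk c hv, h2]
  rw [← mul_assoc, ← mul_assoc, ← ENNReal.ofReal_mul' (by positivity),
    ← ENNReal.ofReal_mul (by positivity)]
  have e1 : ε ^ (1 - a) / D * |(ε ^ ((1 - a) / (-a)))⁻¹| ^ (2 * s - 1) = 1 / D := by
    rw [abs_of_pos (inv_pos.2 hη), ← rpow_neg hε.le, ← rpow_mul hε.le, div_mul_eq_mul_div,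
      ← rpow_add hε]
    have : 1 - a + -((1 - a) / -a) * (2 * s - 1) = 0 := by
      have ha' : a ≠ 0 := ha.ne
      subst hs; field_simp; ring
    rw [this, rpow_zero]
  have e2 : ε ^ (-((1 - a) / (-a))) * |(ε ^ ((1 - a) / (-a)))⁻¹⁻¹| = 1 := by
    rw [inv_inv, abs_of_pos hη, ← rpow_add hε, neg_add_cancel, rpow_zero]
  rw [e1, e2, ENNReal.ofReal_one, one_mul]
lemma integrable_comp_abs_of_integrableOn_Ioi {f : ℝ → ℝ} (hf : IntegrableOn f (Ioi 0)) :
    Integrable fun x => f |x| := by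
  have h1 : IntegrableOn (fun x => f |x|) (Ioi 0) :=
    hf.congr_fun (fun x hx => by simp only [abs_of_pos (mem_Ioi.1 hx)]) measurableSet_Ioi
  have h2 : IntegrableOn (fun x => f |x|) (Iic 0) := by
    rw [← Measure.map_neg_eq_self (volume : Measure ℝ)]
    let m : MeasurableEmbedding fun x : ℝ => -x := (Homeomorph.neg ℝ).measurableEmbedding
    rw [m.integrableOn_map_iff]
    simp_rw [Function.comp_def, abs_neg, neg_preimage, neg_Iic, neg_zero]
    exact Iff.mpr integrableOn_Ici_iff_integrableOn_Ioi h1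
  rw [← integrableOn_univ, ← Iic_union_Ioi (a := (0 : ℝ))]
  exact h2.union h1

/-- The piecewise linear ramp that climbs from `0` to `1` on the unit interval. -/
noncomputable def ramp (x : ℝ) : ℝ := max 0 (min 1 x)

lemma continuous_ramp : Continuous ramp := by unfold ramp; fun_prop

lemma ramp_of_nonpos {x : ℝ} (h : x ≤ 0) : ramp x = 0 := by
  rw [ramp, max_eq_left ((min_le_right _ _).trans h)]

lemma ramp_of_one_le {x : ℝ} (h : 1 ≤ x) : ramp x = 1 := by
  rw [ramp, min_eq_left h, max_eq_right zero_le_one]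

lemma ramp_nonneg (x : ℝ) : 0 ≤ ramp x := le_max_left _ _

lemma ramp_le_one (x : ℝ) : ramp x ≤ 1 := max_le zero_le_one (min_le_left _ _)

lemma abs_ramp_sub_ramp_le (x y : ℝ) : |ramp y - ramp x| ≤ |y - x| :=
  (abs_max_sub_max_le_max _ _ _ _).trans <| max_le (by simp) <|
    (abs_min_sub_min_le_max _ _ _ _).trans <| max_le (by simp) le_rfl

lemma sq_ramp_increment_le (x h : ℝ) : (ramp (h + x) - ramp x) ^ 2 ≤
    (Icc (-|h|) (1 + |h|)).indicator (fun _ => min 1 (|h| ^ 2)) x := by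
  by_cases hx : x ∈ Icc (-|h|) (1 + |h|)
  · rw [indicator_of_mem hx, ← sq_abs]
    refine le_min ?_ ?_
    · refine pow_le_one₀ (abs_nonneg _) (abs_le.2 ⟨?_, ?_⟩) <;>
        linarith [ramp_nonneg x, ramp_nonneg (h + x), ramp_le_one x, ramp_le_one (h + x)]
    · exact pow_le_pow_left₀ (abs_nonneg _)
        ((abs_ramp_sub_ramp_le x (h + x)).trans_eq (by rw [add_sub_cancel_right])) 2
  · rw [indicator_of_notMem hx]
    rw [mem_Icc, not_and_or, not_le, not_le] at hx
    rcases hx with hx | hx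
    · rw [ramp_of_nonpos (by linarith [le_abs_self h]),
        ramp_of_nonpos (by linarith [abs_nonneg h])]
      simp
    · rw [ramp_of_one_le (by linarith [neg_abs_le h]),
        ramp_of_one_le (by linarith [abs_nonneg h])]
      simp

lemma gag_ramp_ne_top {s : ℝ} (h1 : 1 / 2 < s) (h2 : s < 1) : gag s univ ramp ≠ ⊤ := by
  have mr : Measurable ramp := continuous_ramp.measurable
  have e1 : gag s univ ramp = ∫⁻ h, ∫⁻ x,
      ENNReal.ofReal ((ramp (h + x) - ramp x) ^ 2 / |h| ^ (1 + 2 * s)) := by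
    rw [lintegral_lintegral_swap (by fun_prop)]
    simp only [gag, Measure.restrict_univ]
    refine lintegral_congr fun x => ?_
    rw [← lintegral_add_right_eq_self _ x]
    simp only [add_sub_cancel_right]
  let ψ : ℝ → ℝ := fun r => if r ≤ 1 then 3 * r ^ (1 - 2 * s) else 3 * r ^ (-(2 * s))
  have hψ : IntegrableOn ψ (Ioi 0) := by
    rw [← Ioc_union_Ioi_eq_Ioi (zero_le_one (α := ℝ))]
    refine IntegrableOn.union ?_ ?_
    · have : IntegrableOn (fun r : ℝ => 3 * r ^ (1 - 2 * s)) (Ioc 0 1) :=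
        ((intervalIntegrable_iff_integrableOn_Ioc_of_le zero_le_one).1
          (intervalIntegral.intervalIntegrable_rpow' (by linarith))).const_mul 3
      exact this.congr_fun (fun x hx => by simp only [ψ, if_pos hx.2]) measurableSet_Ioc
    · have : IntegrableOn (fun r : ℝ => 3 * r ^ (-(2 * s))) (Ioi 1) :=
        (integrableOn_Ioi_rpow_of_lt (by linarith) one_pos).const_mul 3
      exact this.congr_fun (fun x hx => by simp only [ψ, if_neg (not_le.2 (mem_Ioi.1 hx))])
        measurableSet_Ioi
  have hfin := (integrable_comp_abs_of_integrableOn_Ioi hψ).lintegral_lt_top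
  refine ne_top_of_le_ne_top hfin.ne ?_
  rw [e1]
  refine lintegral_mono_ae ?_
  have h0 : ∀ᵐ h : ℝ, h ≠ 0 := by simp [ae_iff]
  filter_upwards [h0] with h hh
  have hh' : 0 < |h| := abs_pos.2 hh
  calc ∫⁻ x, ENNReal.ofReal ((ramp (h + x) - ramp x) ^ 2 / |h| ^ (1 + 2 * s))
      ≤ ∫⁻ x, (Icc (-|h|) (1 + |h|)).indicator
          (fun _ => ENNReal.ofReal (min 1 (|h| ^ 2) / |h| ^ (1 + 2 * s))) x := by
        refine lintegral_mono fun x => ?_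
        have := sq_ramp_increment_le x h
        by_cases hx : x ∈ Icc (-|h|) (1 + |h|)
        · rw [indicator_of_mem hx] at this ⊢
          exact ENNReal.ofReal_le_ofReal (by gcongr)
        · rw [indicator_of_notMem hx] at this ⊢
          rw [le_antisymm this (sq_nonneg _)]
          simp
    _ = ENNReal.ofReal (min 1 (|h| ^ 2) / |h| ^ (1 + 2 * s) * (1 + 2 * |h|)) := by
        rw [lintegral_indicator_const measurableSet_Icc, Real.volume_Icc,
          ← ENNReal.ofReal_mul (by positivity)]
        congr 2
        ring
    _ ≤ ENNReal.ofReal (ψ |h|) := by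
        apply ENNReal.ofReal_le_ofReal
        by_cases hle : |h| ≤ 1
        · simp only [ψ, if_pos hle]
          have : |h| ^ (1 - 2 * s) = |h| ^ 2 / |h| ^ (1 + 2 * s) := by
            rw [← rpow_natCast, ← rpow_sub hh']
            congr 1
            push_cast; ring
          rw [this, mul_comm]
          gcongr
          · linarith
          · exact min_le_right _ _
        · simp only [ψ, if_neg hle]
          have : |h| ^ (-(2 * s)) = 1 / |h| ^ (1 + 2 * s) * |h| := by
            rw [rpow_add hh', rpow_one, rpow_neg hh'.le]
            field_simp
          rw [this]
          calc min 1 (|h| ^ 2) / |h| ^ (1 + 2 * s) * (1 + 2 * |h|)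
              ≤ 1 / |h| ^ (1 + 2 * s) * (3 * |h|) := by
                gcongr
                · exact min_le_left _ _
                · linarith
            _ = _ := by ring

lemma gag_ramp_shift (s c : ℝ) : gag s univ (fun x => ramp (x + c)) = gag s univ ramp := by
  have := gag_comp_mul_sub s one_ne_zero (-c) continuous_ramp.measurable
  simpa using this

/-- The optimal-profile constant is finite. -/
lemma kappa_ne_top {D s α' β' : ℝ} (h1 : 1 / 2 < s) (h2 : s < 1) {V : ℝ → ℝ} (hVc : Continuous V)
    (hα : V α' = 0) (hβ : V β' = 0) : kappa D s α' β' V ≠ ⊤ := by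
  let v : ℝ → ℝ := fun x => α' + (β' - α') * ramp x
  have mr : Measurable ramp := continuous_ramp.measurable
  have mv : Measurable v := by fun_prop
  have hg : gag s univ v ≠ ⊤ := by
    have := gag_le_of_sq_increment_le s mr mr mv (sq_nonneg (β' - α')) le_rfl
      (fun x y => le_of_eq (by simp only [v]; ring))
    refine ne_top_of_le_ne_top ?_ this
    have := gag_ramp_ne_top h1 h2
    finiteness
  have hV : ∫⁻ x, ENNReal.ofReal (V (v x)) ≠ ⊤ := by
    obtain ⟨C, hC⟩ := (isCompact_Icc (a := (0 : ℝ)) (b := 1)).bddAbove_image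
      (f := fun x => V (α' + (β' - α') * x)) (by fun_prop)
    have : ∀ x, ENNReal.ofReal (V (v x)) ≤
        (Icc (0 : ℝ) 1).indicator (fun _ => ENNReal.ofReal C) x := by
      intro x
      by_cases hx : x ∈ Icc (0 : ℝ) 1
      · rw [indicator_of_mem hx]
        exact ENNReal.ofReal_le_ofReal (hC ⟨ramp x, ⟨ramp_nonneg x, ramp_le_one x⟩, rfl⟩)
      · rw [mem_Icc, not_and_or, not_le, not_le] at hx
        rcases hx with hx | hx
        · simp [v, ramp_of_nonpos hx.le, hα]
        · simp [v, ramp_of_one_le hx.le, hβ]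
    refine ne_top_of_le_ne_top ?_ (lintegral_mono this)
    rw [lintegral_indicator_const measurableSet_Icc, Real.volume_Icc]
    finiteness
  have hG : Gone D s V v ≠ ⊤ := by unfold Gone; finiteness
  refine ne_top_of_le_ne_top hG (sInf_le ⟨v, mv, hG, ?_, ?_, rfl⟩)
  · refine tendsto_const_nhds.congr' ?_
    filter_upwards [eventually_le_atBot 0] with x hx
    simp [v, ramp_of_nonpos hx]
  · refine tendsto_const_nhds.congr' ?_
    filter_upwards [eventually_ge_atTop 1] with x hx
    simp [v, ramp_of_one_le hx]

/-- Clamping the values to the interval between the wells does not increase the energy. -/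
lemma Gone_clamp_le {D s α' β' : ℝ} (hαβ : α' ≤ β') {V : ℝ → ℝ} (hV0 : ∀ t, 0 ≤ V t)
    (hα : V α' = 0) (hβ : V β' = 0) {v : ℝ → ℝ} (hv : Measurable v) :
    Gone D s V (fun x => max α' (min β' (v x))) ≤ Gone D s V v := by
  unfold Gone
  refine add_le_add (mul_le_mul_right ?_ _) (lintegral_mono fun x => ENNReal.ofReal_le_ofReal ?_)
  · have := gag_le_of_sq_increment_le s hv hv (w := fun x => max α' (min β' (v x)))
      (by fun_prop) zero_le_one le_rfl (fun x y => ?_)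
    · simpa using this
    · rw [one_mul, zero_mul, add_zero, sq_le_sq]
      exact (abs_max_sub_max_le_max _ _ _ _).trans <| max_le (by simp) <|
        (abs_min_sub_min_le_max _ _ _ _).trans <| max_le (by simp) le_rfl
  · rcases le_total (v x) α' with h | h
    · simp [max_eq_left ((min_le_right β' (v x)).trans h), hα, hV0]
    · rcases le_total β' (v x) with h' | h'
      · simp [min_eq_left h', max_eq_right hαβ, hβ, hV0]
      · simp only [min_eq_right h', max_eq_right h, le_refl]

lemma sq_add_le_weighted {p q δ : ℝ} (hδ : 0 < δ) :
    (p + q) ^ 2 ≤ (1 + δ) * p ^ 2 + (1 + δ⁻¹) * q ^ 2 := by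
  have h : 0 ≤ δ⁻¹ * (δ * p - q) ^ 2 := by positivity
  have e : δ⁻¹ * (δ * p - q) ^ 2 = δ * p ^ 2 - 2 * p * q + δ⁻¹ * q ^ 2 := by
    field_simp; ring
  nlinarith

/-- A profile converging to a well at `-∞` can be made constant there at an arbitrarily small
cost in energy. -/
lemma exists_truncate_atBot {D s c A B : ℝ} (hD : 0 < D) (h1 : 1 / 2 < s) (h2 : s < 1)
    {V : ℝ → ℝ} (hVc : Continuous V) (hc : V c = 0)
    {v : ℝ → ℝ} (hv : Measurable v) (hvAB : ∀ x, v x ∈ Icc A B) (hcAB : c ∈ Icc A B)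
    (hlim : Tendsto v atBot (nhds c)) (hG : Gone D s V v ≠ ⊤) {κ : ℝ≥0∞} (hκ : Gone D s V v < κ) :
    ∃ v' : ℝ → ℝ, Measurable v' ∧ (∀ x, v' x ∈ Icc A B) ∧ (∀ᶠ x in atBot, v' x = c) ∧
      v' =ᶠ[atTop] v ∧ Gone D s V v' < κ := by
  have mr : Measurable ramp := continuous_ramp.measurable
  have hgag : gag s univ v ≠ ⊤ := by
    intro h
    apply hG
    rw [Gone, h, ENNReal.mul_top (by simpa using hD), top_add]
  set g₀ := gag s univ ramp with hg₀
  have hg₀t : g₀ ≠ ⊤ := gag_ramp_ne_top h1 h2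
  have key : ∀ δ : ℝ, 0 < δ → ∃ v' : ℝ → ℝ, Measurable v' ∧ (∀ x, v' x ∈ Icc A B) ∧
      (∀ᶠ x in atBot, v' x = c) ∧ v' =ᶠ[atTop] v ∧
      Gone D s V v' ≤ ENNReal.ofReal (1 / D) * (ENNReal.ofReal (1 + δ) * gag s univ v +
        ENNReal.ofReal ((1 + δ⁻¹) * δ ^ 2) * g₀) +
        ((∫⁻ x, ENNReal.ofReal (V (v x))) + ENNReal.ofReal δ) := by
    intro δ hδ
    obtain ⟨r, hr, hVr⟩ := Metric.continuousAt_iff.1 hVc.continuousAt δ hδ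
    obtain ⟨R, hR⟩ := eventually_atBot.1
      (Metric.tendsto_nhds.1 hlim (min r δ) (lt_min hr hδ))
    have hvr : ∀ x ≤ R, |v x - c| < r := fun x hx => (hR x hx).trans_le (min_le_left _ _)
    have hvδ : ∀ x ≤ R, |v x - c| ≤ δ := fun x hx => ((hR x hx).trans_le (min_le_right _ _)).le
    let χ : ℝ → ℝ := fun x => ramp (x + (1 - R))
    have mχ : Measurable χ := by fun_prop
    have χ0 : ∀ x, 0 ≤ χ x := fun x => ramp_nonneg _
    have χ1 : ∀ x, χ x ≤ 1 := fun x => ramp_le_one _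
    have χR : ∀ x, R ≤ x → χ x = 1 := fun x hx => ramp_of_one_le (by linarith)
    have χL : ∀ x, x ≤ R - 1 → χ x = 0 := fun x hx => ramp_of_nonpos (by linarith)
    refine ⟨fun x => c + χ x * (v x - c), by fun_prop, ?_, ?_, ?_, ?_⟩
    · intro x
      have := (convex_Icc A B) hcAB (hvAB x) (sub_nonneg.2 (χ1 x)) (χ0 x) (by ring)
      simp only [smul_eq_mul] at this
      convert this using 1
      ring
    · filter_upwards [eventually_le_atBot (R - 1)] with x hx
      simp [χL x hx]
    · filter_upwards [eventually_ge_atTop R] with x hx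
      simp [χR x hx]
    · unfold Gone
      refine add_le_add (mul_le_mul_right ?_ _) ?_
      · rw [hg₀, ← gag_ramp_shift s (1 - R)]
        refine gag_le_of_sq_increment_le s hv mχ (by fun_prop) (by positivity) (by positivity) ?_
        have aux : ∀ τ p q : ℝ, 0 ≤ τ → τ ≤ 1 → ∀ d, |d| ≤ δ →
            (τ * p + d * q) ^ 2 ≤ (1 + δ) * p ^ 2 + (1 + δ⁻¹) * δ ^ 2 * q ^ 2 := by
          intro τ p q hτ0 hτ1 d hd
          refine (sq_add_le_weighted hδ).trans ?_
          rw [mul_pow, mul_pow, mul_assoc]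
          have hτ : τ ^ 2 ≤ 1 := pow_le_one₀ hτ0 hτ1
          have hd2 : d ^ 2 ≤ δ ^ 2 := sq_le_sq' (abs_le.1 hd).1 (abs_le.1 hd).2
          gcongr
          exact mul_le_of_le_one_left (sq_nonneg _) hτ
        intro x y
        rcases le_total x R with hx | hx
        · convert aux (χ y) (v y - v x) (χ y - χ x) (χ0 y) (χ1 y) (v x - c) (hvδ x hx) using 2
          ring
        · rcases le_total y R with hy | hy
          · convert aux (χ x) (v y - v x) (χ y - χ x) (χ0 x) (χ1 x) (v y - c) (hvδ y hy) using 2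
            ring
          · convert aux 1 (v y - v x) (χ y - χ x) zero_le_one le_rfl 0 (by simpa using hδ.le)
              using 2
            rw [χR x hx, χR y hy]
            ring
      · have : ∀ x, ENNReal.ofReal (V (c + χ x * (v x - c))) ≤ ENNReal.ofReal (V (v x)) +
            (Icc (R - 1) R).indicator (fun _ => ENNReal.ofReal δ) x := by
          intro x
          rcases le_total R x with hx | hx
          · simp [χR x hx]
          rcases le_total x (R - 1) with hx' | hx'
          · simp [χL x hx', hc]
          rw [indicator_of_mem (mem_Icc.2 ⟨hx', hx⟩)]
          refine le_add_left (ENNReal.ofReal_le_ofReal ?_)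
          have hd : dist (c + χ x * (v x - c)) c < r := by
            rw [Real.dist_eq, add_sub_cancel_left, abs_mul, abs_of_nonneg (χ0 x)]
            exact (mul_le_of_le_one_left (abs_nonneg _) (χ1 x)).trans_lt (hvr x hx)
          have := hVr hd
          rw [Real.dist_eq, hc, sub_zero] at this
          exact (le_abs_self _).trans this.le
        refine (lintegral_mono this).trans_eq ?_
        rw [lintegral_add_left (by fun_prop), lintegral_indicator_const measurableSet_Icc,
          Real.volume_Icc]
        simp
  have hlim : Tendsto (fun δ : ℝ =>
        ENNReal.ofReal (1 / D) * (ENNReal.ofReal (1 + δ) * gag s univ v +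
        ENNReal.ofReal ((δ ^ 2 + δ)) * g₀) +
        ((∫⁻ x, ENNReal.ofReal (V (v x))) + ENNReal.ofReal δ)) (nhdsWithin 0 (Ioi 0))
        (nhds (ENNReal.ofReal (1 / D) * (ENNReal.ofReal (1 + 0) * gag s univ v +
        ENNReal.ofReal ((0 ^ 2 + 0)) * g₀) +
        ((∫⁻ x, ENNReal.ofReal (V (v x))) + ENNReal.ofReal 0))) := by
    refine tendsto_nhdsWithin_of_tendsto_nhds (Continuous.tendsto ?_ 0)
    have c1 : Continuous fun δ : ℝ => ENNReal.ofReal (1 + δ) * gag s univ v :=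
      (ENNReal.continuous_mul_const hgag).comp (ENNReal.continuous_ofReal.comp (by fun_prop))
    have c2 : Continuous fun δ : ℝ => ENNReal.ofReal (δ ^ 2 + δ) * g₀ :=
      (ENNReal.continuous_mul_const hg₀t).comp (ENNReal.continuous_ofReal.comp (by fun_prop))
    exact ((ENNReal.continuous_const_mul ENNReal.ofReal_ne_top).comp (c1.add c2)).add
      (continuous_const.add ENNReal.continuous_ofReal)
  have hlt : ENNReal.ofReal (1 / D) * (ENNReal.ofReal (1 + 0) * gag s univ v +
        ENNReal.ofReal ((0 ^ 2 + 0)) * g₀) +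
        ((∫⁻ x, ENNReal.ofReal (V (v x))) + ENNReal.ofReal 0) < κ := by
    simpa [Gone] using hκ
  obtain ⟨δ, hδκ, hδ⟩ := ((hlim.eventually_lt_const hlt).and self_mem_nhdsWithin).exists
  obtain ⟨v', m', h1', h2', h3', h4'⟩ := key δ hδ
  refine ⟨v', m', h1', h2', h3', h4'.trans_lt ?_⟩
  convert hδκ using 6
  have : δ ≠ 0 := (mem_Ioi.1 hδ).ne'
  field_simp

/-- Near-optimal profiles that are constant outside a bounded interval. -/
lemma exists_profile {D s α' β' : ℝ} (hD : 0 < D) (h1 : 1 / 2 < s) (h2 : s < 1) (hαβ : α' < β')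
    {V : ℝ → ℝ} (hVc : Continuous V) (hV0 : ∀ t, 0 ≤ V t) (hα : V α' = 0) (hβ : V β' = 0)
    {κ : ℝ≥0∞} (hκ : kappa D s α' β' V < κ) :
    ∃ v : ℝ → ℝ, Measurable v ∧ (∀ x, v x ∈ Icc α' β') ∧ (∀ᶠ x in atBot, v x = α') ∧
      (∀ᶠ x in atTop, v x = β') ∧ Gone D s V v < κ := by
  have mV : Measurable V := hVc.measurable
  obtain ⟨_, ⟨u, mu, hu, hbot, htop, rfl⟩, huκ⟩ := sInf_lt_iff.1 hκ
  let u₀ : ℝ → ℝ := fun x => max α' (min β' (u x))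
  have hle : Gone D s V u₀ ≤ Gone D s V u := Gone_clamp_le hαβ.le hV0 hα hβ mu
  have cont : Continuous fun y : ℝ => max α' (min β' y) := by fun_prop
  have hbot₀ : Tendsto u₀ atBot (nhds α') := by
    have h := (cont.tendsto α').comp hbot
    simp only [min_eq_right hαβ.le, max_self] at h
    exact h
  obtain ⟨u₁, m₁, r₁, b₁, t₁, G₁⟩ := exists_truncate_atBot hD h1 h2 hVc hα
    (v := u₀) (A := α') (B := β') (by fun_prop)
    (fun x => ⟨le_max_left _ _, max_le hαβ.le (min_le_left _ _)⟩) ⟨le_rfl, hαβ.le⟩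
    hbot₀ (ne_top_of_le_ne_top hu hle)
    (hle.trans_lt huκ)
  have htop₁ : Tendsto u₁ atTop (nhds β') := by
    refine Tendsto.congr' t₁.symm ?_
    have h := (cont.tendsto β').comp htop
    simp only [min_self, max_eq_right hαβ.le] at h
    exact h
  obtain ⟨u₂, m₂, r₂, b₂, t₂, G₂⟩ := exists_truncate_atBot hD h1 h2 hVc hβ
    (v := fun x => u₁ (-x)) (A := α') (B := β') (by fun_prop) (fun x => r₁ _)
    ⟨hαβ.le, le_rfl⟩ (htop₁.comp tendsto_neg_atBot_atTop)
    (by rw [Gone_comp_neg D s mV m₁]; exact G₁.ne_top) (by rwa [Gone_comp_neg D s mV m₁])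
  refine ⟨fun x => u₂ (-x), by fun_prop, fun x => r₂ _, ?_,
    tendsto_neg_atTop_atBot.eventually b₂, by rwa [Gone_comp_neg D s mV m₂]⟩
  filter_upwards [tendsto_neg_atBot_atTop.eventually t₂, b₁] with x hx hx'
  rw [hx, neg_neg, hx']

/-- Superposition of transition layers, the `i`-th of which passes from `c i` to `c (i + 1)`. -/
noncomputable def glue (c : ℕ → ℝ) (P : ℕ → ℝ → ℝ) (m : ℕ) (x : ℝ) : ℝ :=
  c 0 + ∑ i ∈ Finset.range m, (P i x - c i)

lemma glue_succ (c : ℕ → ℝ) (P : ℕ → ℝ → ℝ) (m : ℕ) (x : ℝ) :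
    glue c P (m + 1) x = glue c P m x + (P m x - c m) := by
  rw [glue, glue, Finset.sum_range_succ, add_assoc]

/-- The layers `P i` are well separated: `P i` makes its transition within distance `ρ` of
`t (i + 1)`, and distinct transition regions are at distance at least `r`. -/
structure SeparatedLayers (N : ℕ) (t c : ℕ → ℝ) (P : ℕ → ℝ → ℝ) (A B ρ r : ℝ) : Prop where
  left : ∀ i < N, ∀ x ≤ t (i + 1) - ρ, P i x = c i
  right : ∀ i < N, ∀ x, t (i + 1) + ρ ≤ x → P i x = c (i + 1)
  layer_mem : ∀ i < N, ∀ x, P i x ∈ Icc A B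
  value_mem : ∀ i ≤ N, c i ∈ Icc A B
  gap : ∀ i ≤ N, t i + 2 * ρ + r ≤ t (i + 1)
  rho_nonneg : 0 ≤ ρ
  r_pos : 0 < r

namespace SeparatedLayers

variable {N : ℕ} {t c : ℕ → ℝ} {P : ℕ → ℝ → ℝ} {A B ρ r : ℝ}

lemma glue_eq_value (h : SeparatedLayers N t c P A B ρ r) :
    ∀ m ≤ N, ∀ x, t m + ρ ≤ x → glue c P m x = c m := by
  intro m
  induction m with
  | zero => intro _ x _; simp [glue]
  | succ m ih =>
    intro hm x hx
    have hg := h.gap m (by omega)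
    have := h.rho_nonneg
    have := h.r_pos
    rw [glue_succ, ih (by omega) x (by linarith), h.right m (by omega) x hx]
    ring

lemma glue_succ_cases (h : SeparatedLayers N t c P A B ρ r) {m : ℕ} (hm : m < N) (x : ℝ) :
    (x ≤ t (m + 1) - ρ ∧ glue c P (m + 1) x = glue c P m x ∧ P m x = c m) ∨
      (t (m + 1) - ρ ≤ x ∧ glue c P (m + 1) x = P m x ∧ glue c P m x = c m) := by
  rcases le_total x (t (m + 1) - ρ) with hx | hx
  · have hP := h.left m hm x hx
    exact Or.inl ⟨hx, by rw [glue_succ, hP]; ring, hP⟩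
  · have hg := h.gap m hm.le
    have hv := h.glue_eq_value m hm.le x (by linarith [h.r_pos])
    exact Or.inr ⟨hx, by rw [glue_succ, hv]; ring, hv⟩

lemma glue_mem (h : SeparatedLayers N t c P A B ρ r) :
    ∀ m ≤ N, ∀ x, glue c P m x ∈ Icc A B := by
  intro m
  induction m with
  | zero => intro _ x; simpa [glue] using h.value_mem 0 (Nat.zero_le _)
  | succ m ih =>
    intro hm x
    rcases h.glue_succ_cases (m := m) hm x with ⟨-, e, -⟩ | ⟨-, e, -⟩ <;> rw [e]
    · exact ih (by omega) x
    · exact h.layer_mem m hm x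

lemma potential_glue_le (h : SeparatedLayers N t c P A B ρ r) {V : ℝ → ℝ} (hV0 : ∀ t, 0 ≤ V t)
    (hVc : V (c 0) = 0) :
    ∀ m ≤ N, ∀ x, V (glue c P m x) ≤ ∑ i ∈ Finset.range m, V (P i x) := by
  intro m
  induction m with
  | zero => intro _ x; simp [glue, hVc]
  | succ m ih =>
    intro hm x
    rw [Finset.sum_range_succ]
    rcases h.glue_succ_cases (m := m) hm x with ⟨-, e, -⟩ | ⟨-, e, -⟩ <;> rw [e]
    · linarith [ih (by omega) x, hV0 (P m x)]
    · linarith [Finset.sum_nonneg fun i (_ : i ∈ Finset.range m) => hV0 (P i x)]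

lemma sq_glue_increment_le (h : SeparatedLayers N t c P A B ρ r) :
    ∀ m ≤ N, ∀ x y, (glue c P m y - glue c P m x) ^ 2 ≤
      ∑ i ∈ Finset.range m, (P i y - P i x) ^ 2 + if r ≤ |y - x| then (B - A) ^ 2 else 0 := by
  have ite_nonneg : ∀ x y : ℝ, 0 ≤ if r ≤ |y - x| then (B - A) ^ 2 else 0 := by
    intro x y; split_ifs <;> positivity
  intro m
  induction m with
  | zero => intro _ x y; simpa [glue] using ite_nonneg x y
  | succ m ih =>
    intro hm x y
    have mixed : ∀ x y, x ≤ t (m + 1) - ρ → glue c P (m + 1) x = glue c P m x → P m x = c m →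
        t (m + 1) - ρ ≤ y → glue c P (m + 1) y = P m y →
        (glue c P (m + 1) y - glue c P (m + 1) x) ^ 2 ≤
          (P m y - P m x) ^ 2 + if r ≤ |y - x| then (B - A) ^ 2 else 0 := by
      intro x y hx ex px hy ey
      rcases le_total (t m + ρ) x with hx' | hx'
      · rw [ey, ex, h.glue_eq_value m (by omega) x hx', px]
        linarith [ite_nonneg x y]
      · have hg := h.gap m (by omega)
        rw [if_pos ((by linarith : r ≤ y - x).trans (le_abs_self _))]
        have h1 := h.glue_mem (m + 1) hm x
        have h2 := h.glue_mem (m + 1) hm y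
        have : (glue c P (m + 1) y - glue c P (m + 1) x) ^ 2 ≤ (B - A) ^ 2 :=
          sq_le_sq' (by linarith [h1.2, h2.1]) (by linarith [h1.1, h2.2])
        linarith [sq_nonneg (P m y - P m x)]
    rw [Finset.sum_range_succ]
    have hsum : 0 ≤ ∑ i ∈ Finset.range m, (P i y - P i x) ^ 2 :=
      Finset.sum_nonneg fun i _ => sq_nonneg _
    rcases h.glue_succ_cases (m := m) hm x with ⟨hx, ex, px⟩ | ⟨hx, ex, px⟩ <;>
      rcases h.glue_succ_cases (m := m) hm y with ⟨hy, ey, py⟩ | ⟨hy, ey, py⟩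
    · rw [ex, ey]
      linarith [ih (by omega) x y, sq_nonneg (P m y - P m x)]
    · linarith [mixed x y hx ex px hy ey]
    · have := mixed y x hy ey py hx ex
      rw [abs_sub_comm x y, ← neg_sub, neg_sq, ← neg_sub (P m y), neg_sq] at this
      linarith
    · rw [ex, ey]
      linarith [ite_nonneg x y]

lemma glue_eq_of_mem_Icc (h : SeparatedLayers N t c P A B ρ r) {i : ℕ} (hi : i ≤ N) {x : ℝ}
    (hx : x ∈ Icc (t i + ρ) (t (i + 1) - ρ)) : glue c P N x = c i := by
  have key : ∀ m, i ≤ m → m ≤ N → glue c P m x = c i ∧ x ≤ t (m + 1) - ρ := by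
    intro m him
    induction m, him using Nat.le_induction with
    | base => intro _; exact ⟨h.glue_eq_value i hi x hx.1, hx.2⟩
    | succ m _ ih =>
      intro hm
      obtain ⟨e, hxm⟩ := ih (by omega)
      refine ⟨by rw [glue_succ, e, h.left m hm x hxm]; ring, ?_⟩
      linarith [h.gap (m + 1) hm, h.rho_nonneg, h.r_pos]
  exact (key N hi le_rfl).1

end SeparatedLayers

lemma setLIntegral_Ioc_le_sum (t : ℕ → ℝ) (f : ℝ → ℝ≥0∞) (m : ℕ) :
    ∫⁻ x in Ioc (t 0) (t m), f x ≤ ∑ i ∈ Finset.range m, ∫⁻ x in Ioc (t i) (t (i + 1)), f x := by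
  induction m with
  | zero => simp
  | succ m ih =>
    rw [Finset.sum_range_succ]
    exact (lintegral_mono_set Ioc_subset_Ioc_union_Ioc).trans
      ((lintegral_union_le _ _ _).trans (add_le_add_left ih _))

lemma SeparatedLayers.lintegral_glue_sub_le {N : ℕ} {t c : ℕ → ℝ} {P : ℕ → ℝ → ℝ} {A B ρ r : ℝ}
    (h : SeparatedLayers N t c P A B ρ r) {w : ℝ → ℝ}
    (hw : ∀ i ≤ N, ∀ x ∈ Ioo (t i) (t (i + 1)), w x = c i) :
    ∫⁻ x in Ioo (t 0) (t (N + 1)), ENNReal.ofReal |glue c P N x - w x| ≤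
      (N + 1) * (2 * (ENNReal.ofReal (B - A) * ENNReal.ofReal ρ)) := by
  refine (lintegral_mono_set Ioo_subset_Ioc_self).trans
    ((setLIntegral_Ioc_le_sum t _ (N + 1)).trans ?_)
  have : ∀ i ∈ Finset.range (N + 1), ∫⁻ x in Ioc (t i) (t (i + 1)),
      ENNReal.ofReal |glue c P N x - w x| ≤ 2 * (ENNReal.ofReal (B - A) * ENNReal.ofReal ρ) := by
    intro i hi
    have hi : i ≤ N := Nat.lt_succ_iff.1 (Finset.mem_range.1 hi)
    let κ : ℝ → ℝ≥0∞ := fun _ => ENNReal.ofReal (B - A)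
    rw [setLIntegral_congr Ioo_ae_eq_Ioc.symm]
    calc ∫⁻ x in Ioo (t i) (t (i + 1)), ENNReal.ofReal |glue c P N x - w x|
        ≤ ∫⁻ x in Ioo (t i) (t (i + 1)), ((Icc (t i) (t i + ρ)).indicator κ x +
            (Icc (t (i + 1) - ρ) (t (i + 1))).indicator κ x) := by
          refine setLIntegral_mono' measurableSet_Ioo fun x hx => ?_
          rw [hw i hi x hx]
          have hle : ENNReal.ofReal |glue c P N x - c i| ≤ ENNReal.ofReal (B - A) := by
            have h1 := h.glue_mem N le_rfl x
            have h2 := h.value_mem i hi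
            exact ENNReal.ofReal_le_ofReal
              (abs_le.2 ⟨by linarith [h1.1, h2.2], by linarith [h1.2, h2.1]⟩)
          rcases le_total x (t i + ρ) with h1 | h1
          · rw [indicator_of_mem (mem_Icc.2 ⟨hx.1.le, h1⟩)]
            exact le_add_right hle
          rcases le_total (t (i + 1) - ρ) x with h2 | h2
          · rw [indicator_of_mem (s := Icc (t (i + 1) - ρ) _) (mem_Icc.2 ⟨h2, hx.2.le⟩)]
            exact le_add_left hle
          · simp [h.glue_eq_of_mem_Icc hi ⟨h1, h2⟩]
      _ ≤ ∫⁻ x, ((Icc (t i) (t i + ρ)).indicator κ x +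
            (Icc (t (i + 1) - ρ) (t (i + 1))).indicator κ x) := setLIntegral_le_lintegral _ _
      _ = 2 * (ENNReal.ofReal (B - A) * ENNReal.ofReal ρ) := by
          rw [lintegral_add_left (measurable_const.indicator measurableSet_Icc),
            lintegral_indicator_const measurableSet_Icc,
            lintegral_indicator_const measurableSet_Icc, Real.volume_Icc, Real.volume_Icc, two_mul]
          simp
  refine (Finset.sum_le_card_nsmul _ _ _ this).trans_eq ?_
  simp [nsmul_eq_mul]

lemma gag_le_sum_add {s : ℝ} (hs : 0 ≤ s) {E : Set ℝ} {ι : Type*}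
    (I : Finset ι) {P : ι → ℝ → ℝ} (hP : ∀ i ∈ I, Measurable (P i)) {v : ℝ → ℝ} (hv : Measurable v)
    {K r : ℝ} (hK : 0 ≤ K) (hr : 0 < r)
    (h : ∀ x y, (v y - v x) ^ 2 ≤ ∑ i ∈ I, (P i y - P i x) ^ 2 + if r ≤ |y - x| then K else 0) :
    gag s E v ≤ ∑ i ∈ I, gag s univ (P i) +
      ENNReal.ofReal (K / r ^ (1 + 2 * s)) * (volume E * volume E) := by
  rw [gag_eq_lintegral_prod s E hv]
  calc ∫⁻ z in E ×ˢ E, ENNReal.ofReal ((v z.2 - v z.1) ^ 2 / |z.2 - z.1| ^ (1 + 2 * s))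
        ∂(volume.prod volume)
      ≤ ∫⁻ z in E ×ˢ E, (∑ i ∈ I,
          ENNReal.ofReal ((P i z.2 - P i z.1) ^ 2 / |z.2 - z.1| ^ (1 + 2 * s)) +
          ENNReal.ofReal (K / r ^ (1 + 2 * s))) ∂(volume.prod volume) := by
        refine lintegral_mono fun z => ?_
        rw [← ENNReal.ofReal_sum_of_nonneg (fun i _ => by positivity),
          ← ENNReal.ofReal_add (Finset.sum_nonneg fun i _ => by positivity) (by positivity)]
        apply ENNReal.ofReal_le_ofReal
        refine (div_le_div_of_nonneg_right (h z.1 z.2) (by positivity)).trans ?_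
        rw [add_div, Finset.sum_div]
        refine add_le_add le_rfl ?_
        split_ifs with hz
        · gcongr
        · simp only [zero_div]; positivity
    _ = ∑ i ∈ I, (∫⁻ z in E ×ˢ E,
          ENNReal.ofReal ((P i z.2 - P i z.1) ^ 2 / |z.2 - z.1| ^ (1 + 2 * s))
            ∂(volume.prod volume)) +
          ENNReal.ofReal (K / r ^ (1 + 2 * s)) * (volume E * volume E) := by
        rw [lintegral_add_right _ measurable_const,
          lintegral_finsetSum' _ fun i hi => (measurable_gag_kernel s (hP i hi)).aemeasurable,
          setLIntegral_const, Measure.prod_prod]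
    _ ≤ _ := by
        gcongr with i hi
        rw [gag_eq_lintegral_prod s univ (hP i hi)]
        exact lintegral_mono_set (prod_mono (subset_univ _) (subset_univ _))

lemma measurable_glue {N : ℕ} (c : ℕ → ℝ) {P : ℕ → ℝ → ℝ} (hP : ∀ i < N, Measurable (P i)) :
    Measurable (glue c P N) :=
  measurable_const.add <| Finset.measurable_fun_sum _ fun i hi =>
    (hP i (Finset.mem_range.1 hi)).sub_const _

lemma SeparatedLayers.Gfun_glue_le {N : ℕ} {t c : ℕ → ℝ} {P : ℕ → ℝ → ℝ} {A B ρ r : ℝ}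
    (h : SeparatedLayers N t c P A B ρ r) (hP : ∀ i < N, Measurable (P i)) {s : ℝ} (hs : 0 ≤ s)
    {V : ℝ → ℝ} (hV : Measurable V) (hV0 : ∀ t, 0 ≤ V t) (hVc : V (c 0) = 0) (a D ε : ℝ)
    (E : Set ℝ) :
    Gfun a s D V ε E (glue c P N) ≤ ∑ i ∈ Finset.range N, Gfun a s D V ε univ (P i) +
      ENNReal.ofReal (ε ^ (1 - a) / D) *
        (ENNReal.ofReal ((B - A) ^ 2 / r ^ (1 + 2 * s)) * (volume E * volume E)) := by
  have hP' : ∀ i ∈ Finset.range N, Measurable (P i) := fun i hi => hP i (Finset.mem_range.1 hi)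
  have h1 := gag_le_sum_add hs (E := E) _ hP' (measurable_glue c hP) (sq_nonneg _) h.r_pos
    (h.sq_glue_increment_le N le_rfl)
  have h2 : ∫⁻ x in E, ENNReal.ofReal (V (glue c P N x)) ≤
      ∑ i ∈ Finset.range N, ∫⁻ x in univ, ENNReal.ofReal (V (P i x)) := by
    rw [← lintegral_finsetSum' _ fun i hi => by
      have := hP' i hi
      fun_prop]
    refine (lintegral_mono_set (subset_univ _)).trans (lintegral_mono fun x => ?_)
    rw [← ENNReal.ofReal_sum_of_nonneg fun i _ => hV0 _]
    exact ENNReal.ofReal_le_ofReal (h.potential_glue_le hV0 hVc N le_rfl x)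
  unfold Gfun
  rw [Finset.sum_add_distrib, ← Finset.mul_sum, ← Finset.mul_sum]
  calc _ ≤ ENNReal.ofReal (ε ^ (1 - a) / D) * (∑ i ∈ Finset.range N, gag s univ (P i) +
      ENNReal.ofReal ((B - A) ^ 2 / r ^ (1 + 2 * s)) * (volume E * volume E)) + _ :=
        add_le_add (mul_le_mul_right h1 _) (mul_le_mul_right h2 _)
    _ = _ := by rw [mul_add, add_right_comm]

lemma exists_uniform_gap {N : ℕ} {t : ℕ → ℝ} (ht : ∀ i ≤ N, t i < t (i + 1)) :
    ∃ g > 0, ∀ i ≤ N, t i + g ≤ t (i + 1) := by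
  obtain ⟨j, hj, hmin⟩ := Finset.exists_min_image (Finset.range (N + 1))
    (fun i => t (i + 1) - t i) ⟨0, by simp⟩
  refine ⟨t (j + 1) - t j, sub_pos.2 (ht j (Nat.lt_succ_iff.1 (Finset.mem_range.1 hj))),
    fun i hi => ?_⟩
  linarith [hmin i (Finset.mem_range.2 (Nat.lt_succ_iff.2 hi))]

/-- Rescaled copies of a profile, suitably reflected, centred at the jump points of a step
function. -/
lemma separatedLayers_rescale {N : ℕ} {t c : ℕ → ℝ} {α' β' g η R : ℝ} (hαβ : α' < β')
    (hg : 0 < g) (ht : ∀ i ≤ N, t i + g ≤ t (i + 1)) (hc : ∀ i ≤ N, c i = α' ∨ c i = β')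
    (hcjump : ∀ i < N, c i ≠ c (i + 1)) {p : ℝ → ℝ} (hp : ∀ x, p x ∈ Icc α' β')
    (hpl : ∀ x ≤ -R, p x = α') (hpr : ∀ x, R ≤ x → p x = β') (hR : 0 ≤ R) (hη : 0 < η)
    (hηR : η * R ≤ g / 4) :
    SeparatedLayers N t c
      (fun i x => (if c i = α' then p else fun y => p (-y)) (η⁻¹ * (x - t (i + 1))))
      α' β' (η * R) (g / 2) where
  left := by
    intro i hi x hx
    have hy : η⁻¹ * (x - t (i + 1)) ≤ -R := by
      rw [inv_mul_le_iff₀ hη]; linarith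
    split_ifs with h
    · rw [hpl _ hy, h]
    · beta_reduce
      rw [hpr _ (by linarith), (hc i hi.le).resolve_left h]
  right := by
    intro i hi x hx
    have hy : R ≤ η⁻¹ * (x - t (i + 1)) := by
      rw [le_inv_mul_iff₀ hη]; linarith
    have hne := hcjump i hi
    split_ifs with h
    · rw [hpr _ hy, (hc (i + 1) hi).resolve_left fun h' => hne (h.trans h'.symm)]
    · have hb := (hc i hi.le).resolve_left h
      beta_reduce
      rw [hpl _ (by linarith), (hc (i + 1) hi).resolve_right fun h' => hne (hb.trans h'.symm)]
  layer_mem := by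
    intro i _ x
    split_ifs <;> exact hp _
  value_mem := by
    intro i hi
    rcases hc i hi with h | h <;> rw [h]
    exacts [⟨le_rfl, hαβ.le⟩, ⟨hαβ.le, le_rfl⟩]
  gap := fun i hi => by linarith [ht i hi]
  rho_nonneg := by positivity
  r_pos := by positivity

/- STATEMENT 16: Γ-limsup inequality (recovery sequence). If w is a step function on
E = (a₀, b₀) with values in {α', β'} and exactly N jumps, then for every ε_n → 0⁺ there
are measurable v_n with finite energy, v_n → w in L¹(E), and
limsup G_{ε_n}[v_n, E] ≤ N·κ_s. -/
theorem stmt_16 (a s D α' β' : ℝ) (V : ℝ → ℝ)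
    (ha : a ∈ Set.Ioo (-1 : ℝ) 0) (hs : s = (1 - a) / 2) (hD : 0 < D) (hαβ : α' < β')
    (hV0 : ∀ t, 0 ≤ V t) (hVc : Continuous V)
    (hVz : ∀ t, V t = 0 ↔ t = α' ∨ t = β')
    (a₀ b₀ : ℝ) (hab : a₀ < b₀) (N : ℕ)
    (w : ℝ → ℝ) (t : ℕ → ℝ) (cvals : ℕ → ℝ)
    (ht0 : t 0 = a₀) (htN : t (N + 1) = b₀) (htmono : ∀ i ≤ N, t i < t (i + 1))
    (hc : ∀ i ≤ N, cvals i = α' ∨ cvals i = β')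
    (hcjump : ∀ i < N, cvals i ≠ cvals (i + 1))
    (hw : ∀ i ≤ N, ∀ x ∈ Ioo (t i) (t (i + 1)), w x = cvals i)
    (ε : ℕ → ℝ) (hε : ∀ n, 0 < ε n) (hε0 : Tendsto ε atTop (nhds 0)) :
    ∃ v : ℕ → ℝ → ℝ, (∀ n, Measurable (v n)) ∧
      (∀ n, Gfun a s D V (ε n) (Ioo a₀ b₀) (v n) ≠ ⊤) ∧
      Tendsto (fun n => ∫⁻ x in Ioo a₀ b₀, ENNReal.ofReal |v n x - w x|)
        atTop (nhds 0) ∧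
      Filter.limsup (fun n => Gfun a s D V (ε n) (Ioo a₀ b₀) (v n)) atTop ≤
        (N : ℝ≥0∞) * kappa D s α' β' V := by
  obtain ⟨ha1, ha0⟩ := ha
  have h1 : 1 / 2 < s := by linarith
  have h2 : s < 1 := by linarith
  have hα : V α' = 0 := (hVz _).2 (Or.inl rfl)
  have hβ : V β' = 0 := (hVz _).2 (Or.inr rfl)
  have mV : Measurable V := hVc.measurable
  have hκ : kappa D s α' β' V ≠ ⊤ := kappa_ne_top h1 h2 hVc hα hβ
  set κ := kappa D s α' β' V
  let defect : ℕ → (ℝ → ℝ) → ℝ≥0∞ := fun n v =>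
    (∫⁻ x in Ioo a₀ b₀, ENNReal.ofReal |v x - w x|) +
      (Gfun a s D V (ε n) (Ioo a₀ b₀) v - N * κ)
  let Adm : ℕ → Set (ℝ → ℝ) := fun n =>
    {v | Measurable v ∧ Gfun a s D V (ε n) (Ioo a₀ b₀) v ≠ ⊤}
  have hAdm : ∀ n, (Adm n).Nonempty := fun n =>
    ⟨fun _ => α', measurable_const, by simp [Gfun, gag, hα]⟩
  have approx : ∀ δ : ℝ≥0∞, 0 < δ → ∀ᶠ n in atTop, ∃ v ∈ Adm n, defect n v ≤ (N + 2) * δ := by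
    intro δ hδ
    obtain ⟨p, mp, hp, hpbot, hptop, hpκ⟩ := exists_profile hD h1 h2 hαβ hVc hV0 hα hβ
      (ENNReal.lt_add_right hκ hδ.ne')
    obtain ⟨R₁, hR₁⟩ := eventually_atBot.1 hpbot
    obtain ⟨R₂, hR₂⟩ := eventually_atTop.1 hptop
    let R := max (-R₁) (max R₂ 0)
    have hRR₁ : -R₁ ≤ R := le_max_left _ _
    have hRR₂ : R₂ ≤ R := (le_max_left _ _).trans (le_max_right _ _)
    have hR0 : 0 ≤ R := (le_max_right _ _).trans (le_max_right _ _)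
    obtain ⟨g, hg, hgap⟩ := exists_uniform_gap htmono
    let η : ℕ → ℝ := fun n => ε n ^ ((1 - a) / (-a))
    have hη : ∀ n, 0 < η n := fun n => rpow_pos_of_pos (hε n) _
    have hη0 : Tendsto (fun n => η n * R) atTop (nhds 0) := by
      have hpos : 0 < (1 - a) / (-a) := div_pos (by linarith) (by linarith)
      have := (hε0.rpow_const (p := (1 - a) / (-a)) (Or.inr hpos.le)).mul_const R
      rwa [zero_rpow hpos.ne', zero_mul] at this
    have hL1 : Tendsto (fun n => ((N : ℝ≥0∞) + 1) *
        (2 * (ENNReal.ofReal (β' - α') * ENNReal.ofReal (η n * R)))) atTop (nhds 0) := by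
      have h := ENNReal.tendsto_ofReal hη0
      rw [ENNReal.ofReal_zero] at h
      have h := ENNReal.Tendsto.const_mul (a := (N : ℝ≥0∞) + 1)
        (ENNReal.Tendsto.const_mul (a := 2) (ENNReal.Tendsto.const_mul
          (a := ENNReal.ofReal (β' - α')) h (Or.inr ENNReal.ofReal_ne_top))
          (Or.inr ENNReal.ofNat_ne_top)) (Or.inr (by finiteness))
      simpa using h
    set T : ℝ≥0∞ := ENNReal.ofReal ((β' - α') ^ 2 / (g / 2) ^ (1 + 2 * s)) *
      (volume (Ioo a₀ b₀) * volume (Ioo a₀ b₀)) with hT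
    have hTtop : T ≠ ⊤ := by
      rw [hT, Real.volume_Ioo]
      finiteness
    have htail : Tendsto (fun n => ENNReal.ofReal (ε n ^ (1 - a) / D) * T) atTop (nhds 0) := by
      have h := (hε0.rpow_const (p := 1 - a) (Or.inr (by linarith))).div_const D
      rw [zero_rpow (by linarith), zero_div] at h
      have h := ENNReal.Tendsto.mul_const (ENNReal.tendsto_ofReal h) (Or.inr hTtop)
      simpa using h
    filter_upwards [ENNReal.tendsto_nhds_zero.1 hL1 δ hδ, ENNReal.tendsto_nhds_zero.1 htail δ hδ,
      hη0.eventually_le_const (show (0 : ℝ) < g / 4 by positivity)] with n hn₁ hn₂ hn₃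
    have sep := separatedLayers_rescale hαβ hg hgap hc hcjump hp
      (fun x hx => hR₁ x (by linarith)) (fun x hx => hR₂ x (by linarith)) hR0 (hη n) hn₃
    set P : ℕ → ℝ → ℝ := fun i x =>
      (if cvals i = α' then p else fun y => p (-y)) ((η n)⁻¹ * (x - t (i + 1))) with hPdef
    have mp' : ∀ i, Measurable (if cvals i = α' then p else fun y => p (-y)) := by
      intro i; split_ifs <;> fun_prop
    have mP : ∀ i < N, Measurable (P i) := fun i _ => (mp' i).comp (by fun_prop)
    have eP : ∀ i, Gfun a s D V (ε n) univ (P i) = Gone D s V p := by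
      intro i
      have := Gfun_rescale (D := D) ha0 hs (hε n) mV (mp' i) (t (i + 1))
      refine this.trans ?_
      split_ifs
      · rfl
      · exact Gone_comp_neg D s mV mp
    have hV0c : V (cvals 0) = 0 := by
      rcases hc 0 (Nat.zero_le _) with h | h <;> rw [h] <;> assumption
    have hG := sep.Gfun_glue_le mP (by linarith : (0 : ℝ) ≤ s) mV hV0 hV0c a D (ε n) (Ioo a₀ b₀)
    simp_rw [eP] at hG
    rw [Finset.sum_const, Finset.card_range, nsmul_eq_mul, ← hT] at hG
    have hL := sep.lintegral_glue_sub_le hw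
    rw [ht0, htN] at hL
    refine ⟨glue cvals P N, ⟨measurable_glue _ mP, ne_top_of_le_ne_top ?_ hG⟩, ?_⟩
    · have := hpκ.ne_top
      finiteness
    · calc defect n (glue cvals P N) ≤ δ + (N + 1) * δ := by
            refine add_le_add (hL.trans hn₁) (tsub_le_iff_left.2 (hG.trans ?_))
            calc (N : ℝ≥0∞) * Gone D s V p + ENNReal.ofReal (ε n ^ (1 - a) / D) * T
                ≤ N * (κ + δ) + δ := add_le_add (mul_le_mul_right hpκ.le _) hn₂
              _ = N * κ + (N + 1) * δ := by ring
        _ = (N + 2) * δ := by ring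
  let best : ℕ → ℝ≥0∞ := fun n => ⨅ v ∈ Adm n, defect n v
  have hbest : Tendsto best atTop (nhds 0) := by
    refine ENNReal.tendsto_nhds_zero.2 fun τ hτ => ?_
    have hN : ((N : ℝ≥0∞) + 2) ≠ ⊤ := by finiteness
    filter_upwards [approx (τ / (N + 2)) (ENNReal.div_pos hτ.ne' hN)] with n ⟨v, hv, hle⟩
    exact (iInf₂_le v hv).trans (hle.trans ENNReal.mul_div_le)
  have hinv : Tendsto (fun n : ℕ => ((n : ℝ≥0∞) + 1)⁻¹) atTop (nhds 0) := by
    have := (tendsto_add_atTop_iff_nat 1).2 ENNReal.tendsto_inv_nat_nhds_zero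
    simpa using this
  have select : ∀ n, ∃ v ∈ Adm n, defect n v ≤ best n + ((n : ℝ≥0∞) + 1)⁻¹ := by
    intro n
    by_cases htop : best n = ⊤
    · obtain ⟨v, hv⟩ := hAdm n
      exact ⟨v, hv, by simp [htop]⟩
    · have hlt : best n < best n + ((n : ℝ≥0∞) + 1)⁻¹ :=
        ENNReal.lt_add_right htop (ENNReal.inv_ne_zero.2 (by finiteness))
      obtain ⟨v, hv, hlt⟩ : ∃ v, ∃ _ : v ∈ Adm n, _ := by simpa only [best, iInf_lt_iff] using hlt
      exact ⟨v, hv, hlt.le⟩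
  choose v hv hle using select
  have hdefect : Tendsto (fun n => defect n (v n)) atTop (nhds 0) := by
    have := hbest.add hinv
    rw [add_zero] at this
    exact tendsto_of_tendsto_of_tendsto_of_le_of_le tendsto_const_nhds this
      (fun _ => zero_le) hle
  refine ⟨v, fun n => (hv n).1, fun n => (hv n).2, ?_, ?_⟩
  · exact tendsto_of_tendsto_of_tendsto_of_le_of_le tendsto_const_nhds hdefect
      (fun _ => zero_le) (fun n => le_self_add)
  · have hlim : Tendsto (fun n => (N : ℝ≥0∞) * κ + defect n (v n)) atTop (nhds (N * κ)) := by
      simpa using hdefect.const_add ((N : ℝ≥0∞) * κ)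
    rw [← hlim.limsup_eq]
    refine limsup_le_limsup (Eventually.of_forall fun n => ?_)
    exact le_add_tsub.trans (add_le_add le_rfl le_add_self)
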